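/- Let p be an odd prime, let i < i₁ < i₂ be natural numbers, set S = {i, i+1, …, i₁−1} and T = {i₁, …, i₂−1}, and assume a_i ≠ 0, a_{i₁} ≥ 2, and a_{i₂} ≠ 0 (so S and T are down-admissible for v and T is down-admissible for v[S]). Put M := ∑_{k ≥ i₂} a_k p^k − ∑_{k=i₁}^{i₂−1} a_k p^k. Then the rational number q := λ_{v,T} / λ_{v[S],T} satisfies q = (−1)^{p^{i₁}} · M/(M + p^{i₁}); in particular q has p-adic valuation 0, and the p-adic valuation of (a_{i₁} − 1)·q + a_{i₁} is at least 1 (i.e. q ≡ −a_{i₁}/(a_{i₁}−1) modulo p). -/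

import Mathlib

namespace SL2Tilt

/-- The `i`-th `p`-adic digit of `v`. -/
def dig (p v i : ℕ) : ℕ := v / p ^ i % p

/-- A stretch: a nonempty finite set of consecutive integers. -/
def IsStretch (S : Finset ℕ) : Prop :=
  S.Nonempty ∧ ∀ a ∈ S, ∀ b ∈ S, ∀ c, a ≤ c → c ≤ b → c ∈ S

/-- `S` is down-admissible for `v` (with respect to the prime `p`):
(d1) the digit of `v` at the minimum of each maximal stretch of `S` is nonzero, and
(d2) if `s ∈ S` and the `(s+1)`-st digit is `0`, then `s + 1 ∈ S`. -/
def DownAdm (p v : ℕ) (S : Finset ℕ) : Prop :=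
  (∀ s ∈ S, (s = 0 ∨ s - 1 ∉ S) → dig p v s ≠ 0) ∧
  (∀ s ∈ S, dig p v (s + 1) = 0 → s + 1 ∈ S)

/-- `S` is up-admissible for `v` (with respect to the prime `p`):
(u1) the digit of `v` at the minimum of each maximal stretch of `S` is nonzero, and
(u2) if `s ∈ S` and the `(s+1)`-st digit is `p - 1`, then `s + 1 ∈ S`. -/
def UpAdm (p v : ℕ) (S : Finset ℕ) : Prop :=
  (∀ s ∈ S, (s = 0 ∨ s - 1 ∉ S) → dig p v s ≠ 0) ∧
  (∀ s ∈ S, dig p v (s + 1) = p - 1 → s + 1 ∈ S)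

/-- `v[S] = ∑ᵢ εᵢ aᵢ pⁱ` (εᵢ = -1 for i ∈ S, else 1), as an integer.
All nonzero digits of `v` have index `< v`, so the range `Finset.range v ∪ S` suffices. -/
def vdown (p v : ℕ) (S : Finset ℕ) : ℤ :=
  ∑ i ∈ Finset.range v ∪ S,
    (if i ∈ S then (-1 : ℤ) else 1) * (dig p v i : ℤ) * (p : ℤ) ^ i

/-- `v(S) = ∑ᵢ aᵢ' pⁱ` where `aᵢ' = -aᵢ` if `i ∈ S`, `aᵢ' = aᵢ + 2` if `i ∉ S` and
`i - 1 ∈ S`, and `aᵢ' = aᵢ` otherwise; as an integer. -/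
def vup (p v : ℕ) (S : Finset ℕ) : ℤ :=
  ∑ i ∈ Finset.range v ∪ S ∪ S.image (· + 1),
    (if i ∈ S then -(dig p v i : ℤ)
      else if i - 1 ∈ S then (dig p v i : ℤ) + 2
      else (dig p v i : ℤ)) * (p : ℤ) ^ i

/-- `v[S]` as a natural number. -/
def vdownN (p v : ℕ) (S : Finset ℕ) : ℕ := (vdown p v S).toNat

/-- `v(S)` as a natural number. -/
def vupN (p v : ℕ) (S : Finset ℕ) : ℕ := (vup p v S).toNat

/-- `fancest' p v s` is `v` with the `p`-adic digits in positions `< s` set to zero.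
This is the ancestor `fancest_{s-1}(v)` of the paper: the youngest ancestor of `v`
whose `(s-1)`-st digit is zero (with `fancest' p v 0 = fancest_{-1}(v) = v`). -/
def fancest' (p v s : ℕ) : ℕ := p ^ s * (v / p ^ s)

/-- The scalar `λ_{v,S} = ∏_{s ∈ S} (-1)^(a_s p^s) · fancest_{s-1}(v)[S]± / fancest_s(v)[S]±`. -/
def lam (p v : ℕ) (S : Finset ℕ) : ℚ :=
  ∏ s ∈ S,
    (-1 : ℚ) ^ (dig p v s * p ^ s) *
      ((vdown p (fancest' p v s) S : ℚ) / (vdown p (fancest' p v (s + 1)) S : ℚ))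

/-- The generation of `v` : the number of (matrilineal) ancestors of `v`, i.e. the
number of nonzero `p`-adic digits of `v` minus one. -/
def gen (p v : ℕ) : ℕ :=
  ((Finset.range v).filter (fun i => dig p v i ≠ 0)).card - 1

/-- A minimal down-admissible stretch for `v`: a down-admissible stretch, no proper
nonempty subset of which is down-admissible for `v`. -/
def MinDownStretch (p v : ℕ) (S : Finset ℕ) : Prop :=
  DownAdm p v S ∧ IsStretch S ∧ ∀ T ⊂ S, T.Nonempty → ¬ DownAdm p v T

/-- A minimal up-admissible stretch for `v`. -/
def MinUpStretch (p v : ℕ) (S : Finset ℕ) : Prop :=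
  UpAdm p v S ∧ IsStretch S ∧ ∀ T ⊂ S, T.Nonempty → ¬ UpAdm p v T

/-- `A` and `B` are distant: `d(A,B) > 1`, i.e. `|a - b| > 1` for all `a ∈ A`, `b ∈ B`. -/
def Distant (A B : Finset ℕ) : Prop :=
  ∀ a ∈ A, ∀ b ∈ B, a + 1 < b ∨ b + 1 < a

lemma sum_dig (p u n : ℕ) :
    ∑ k ∈ Finset.range n, (dig p u k : ℤ) * (p : ℤ) ^ k = ((u % p ^ n : ℕ) : ℤ) := by
  induction n with
  | zero => simp [Nat.mod_one]
  | succ n ih =>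
    rw [Finset.sum_range_succ, ih, Nat.mod_pow_succ]
    simp only [dig]
    push_cast
    ring

lemma sum_dig_Ico (p u a b : ℕ) (hab : a ≤ b) :
    ∑ k ∈ Finset.Ico a b, (dig p u k : ℤ) * (p : ℤ) ^ k
      = ((u % p ^ b : ℕ) : ℤ) - ((u % p ^ a : ℕ) : ℤ) := by
  rw [Finset.sum_Ico_eq_sub _ hab, sum_dig, sum_dig]

lemma lt_pow_of_le (p u n : ℕ) (hp : 2 ≤ p) (h : u ≤ n) : u < p ^ n :=
  lt_of_le_of_lt h (Nat.lt_pow_self (by omega))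

lemma vdown_Ico (p u a b : ℕ) (hp : 2 ≤ p) (hab : a ≤ b) :
    vdown p u (Finset.Ico a b)
      = (u : ℤ) - 2 * (((u % p ^ b : ℕ) : ℤ) - ((u % p ^ a : ℕ) : ℤ)) := by
  have hsub : Finset.range u ∪ Finset.Ico a b ⊆ Finset.range (max u b) := by
    intro x hx
    simp only [Finset.mem_union, Finset.mem_range, Finset.mem_Ico] at *
    omega
  have hsub2 : Finset.Ico a b ⊆ Finset.range (max u b) := by
    intro x hx
    simp only [Finset.mem_range, Finset.mem_Ico] at *
    omega
  unfold vdown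
  rw [Finset.sum_subset hsub]
  · have e : ∀ k ∈ Finset.range (max u b),
        (if k ∈ Finset.Ico a b then (-1 : ℤ) else 1) * (dig p u k : ℤ) * (p : ℤ) ^ k
        = (dig p u k : ℤ) * (p : ℤ) ^ k
          - 2 * (if k ∈ Finset.Ico a b then (dig p u k : ℤ) * (p : ℤ) ^ k else 0) := by
      intro k _
      split_ifs <;> ring
    rw [Finset.sum_congr rfl e, Finset.sum_sub_distrib, ← Finset.mul_sum, sum_dig,
      Finset.sum_ite_mem, Finset.inter_eq_right.mpr hsub2, sum_dig_Ico p u a b hab,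
      Nat.mod_eq_of_lt (lt_pow_of_le p u _ hp (le_max_left _ _))]
  · intro x _ hx
    simp only [Finset.mem_union, Finset.mem_range, not_or, not_lt] at hx
    have : dig p u x = 0 := by
      unfold dig
      rw [Nat.div_eq_of_lt (lt_pow_of_le p u x hp hx.1), Nat.zero_mod]
    simp [this]

/-- Closed form of `fancest_{s-1}(u)[S]±`, with `S = {a,…,b-1}` and `a ≤ s ≤ b`. -/
def aux (p u b s : ℕ) : ℤ :=
  2 * ((p ^ b * (u / p ^ b) : ℕ) : ℤ) - ((p ^ s * (u / p ^ s) : ℕ) : ℤ)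

lemma vdown_fancest (p u a b s : ℕ) (hp : 2 ≤ p) (has : a ≤ s) (hsb : s ≤ b) :
    vdown p (fancest' p u s) (Finset.Ico a b) = aux p u b s := by
  rw [vdown_Ico p _ a b hp (has.trans hsb)]
  have hdiv : fancest' p u s / p ^ b = u / p ^ b := by
    obtain ⟨t, rfl⟩ := Nat.exists_eq_add_of_le hsb
    unfold fancest'
    rw [pow_add, ← Nat.div_div_eq_div_mul, ← Nat.div_div_eq_div_mul,
      Nat.mul_div_cancel_left _ (by positivity)]
  have h0 : fancest' p u s % p ^ a = 0 :=
    Nat.mod_eq_zero_of_dvd (Dvd.dvd.mul_right (pow_dvd_pow p has) _)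
  have h1 := Nat.div_add_mod (fancest' p u s) (p ^ b)
  rw [hdiv] at h1
  rw [h0]
  unfold aux
  change _ = _ - ((fancest' p u s : ℕ) : ℤ)
  omega

lemma aux_pos (p u b s : ℕ) (hp : 2 ≤ p) (hu : u / p ^ b ≠ 0) : 0 < aux p u b s := by
  unfold aux
  have h1 : p ^ s * (u / p ^ s) ≤ u := Nat.mul_div_le _ _
  have h2 := Nat.div_add_mod u (p ^ b)
  have h3 : u % p ^ b < p ^ b := Nat.mod_lt _ (by positivity)
  have h4 : p ^ b ≤ p ^ b * (u / p ^ b) := Nat.le_mul_of_pos_right _ (Nat.pos_of_ne_zero hu)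
  omega

lemma prod_tele (f : ℕ → ℚ) (hf : ∀ n, f n ≠ 0) (a b : ℕ) (hab : a ≤ b) :
    ∏ s ∈ Finset.Ico a b, f s / f (s + 1) = f a / f b := by
  induction b, hab using Nat.le_induction with
  | base => simp [hf a]
  | succ n hn ih =>
    rw [Finset.prod_Ico_succ_top hn, ih]
    field_simp [hf]

lemma lam_Ico (p u a b : ℕ) (hp : 2 ≤ p) (hab : a ≤ b) (hu : u / p ^ b ≠ 0) :
    lam p u (Finset.Ico a b) = (∏ s ∈ Finset.Ico a b, (-1 : ℚ) ^ (dig p u s * p ^ s))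
      * ((aux p u b a : ℚ) / (aux p u b b : ℚ)) := by
  unfold lam
  rw [Finset.prod_mul_distrib, ← prod_tele (fun s => (aux p u b s : ℚ)) _ a b hab]
  · congr 1
    refine Finset.prod_congr rfl fun s hs => ?_
    rw [Finset.mem_Ico] at hs
    rw [vdown_fancest p u a b s hp hs.1 hs.2.le,
      vdown_fancest p u a b (s + 1) hp (by omega) (by omega)]
  · intro n
    exact_mod_cast (aux_pos p u b n hp hu).ne'

/-- Division of `v[S]` by `p^{i₁}`. -/
lemma vdownN_div (p v i i₁ : ℕ) (hp : 2 ≤ p) (h1 : i < i₁) (hai : dig p v i ≠ 0)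
    (hy : v / p ^ i₁ ≠ 0) :
    vdownN p v (Finset.Ico i i₁) / p ^ i₁ = v / p ^ i₁ - 1 := by
  have e := vdown_Ico p v i i₁ hp h1.le
  have h2 := Nat.div_add_mod v (p ^ i₁)
  have h3 : v % p ^ i₁ < p ^ i₁ := Nat.mod_lt _ (by positivity)
  have h4 : v % p ^ i < p ^ i := Nat.mod_lt _ (by positivity)
  have h5 : p ^ i + v % p ^ i ≤ v % p ^ i₁ := by
    have a1 : v % p ^ (i + 1) ≤ v % p ^ i₁ := by
      rw [← Nat.mod_mod_of_dvd v (pow_dvd_pow p (show i + 1 ≤ i₁ from h1))]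
      exact Nat.mod_le _ _
    rw [Nat.mod_pow_succ] at a1
    have : p ^ i ≤ p ^ i * (v / p ^ i % p) := Nat.le_mul_of_pos_right _ (Nat.pos_of_ne_zero hai)
    omega
  obtain ⟨y, hy'⟩ := Nat.exists_eq_succ_of_ne_zero hy
  rw [hy'] at h2 ⊢
  rw [Nat.mul_succ] at h2
  unfold vdownN
  rw [e]
  have : ((v : ℤ) - 2 * (((v % p ^ i₁ : ℕ) : ℤ) - ((v % p ^ i : ℕ) : ℤ))).toNat
      = p ^ i₁ * y + (p ^ i₁ + 2 * (v % p ^ i) - v % p ^ i₁) := by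
    omega
  rw [this, Nat.mul_add_div (by positivity), Nat.div_eq_of_lt (by omega)]
  simp

lemma pred_div (p y t : ℕ) (hp : 2 ≤ p) (hy : y % p ≠ 0) : (y - 1) / p ^ (t + 1) = y / p ^ (t + 1) := by
  rw [pow_succ', ← Nat.div_div_eq_div_mul, ← Nat.div_div_eq_div_mul]
  congr 1
  have h := Nat.div_add_mod y p
  have h' : y % p < p := Nat.mod_lt _ (by omega)
  have : y - 1 = p * (y / p) + (y % p - 1) := by omega
  rw [this, Nat.mul_add_div (by omega),
    Nat.div_eq_of_lt (show y % p - 1 < p by omega), add_zero]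

/-- For an odd prime `p`, adjacent stretches `S = {i,…,i₁-1}` and `T = {i₁,…,i₂-1}`
with `a_i ≠ 0`, `a_{i₁} ≥ 2`, `a_{i₂} ≠ 0`, and
`M = ∑_{k ≥ i₂} a_k p^k - ∑_{k = i₁}^{i₂-1} a_k p^k`, the quotient
`q = λ_{v,T} / λ_{v[S],T}` equals `(-1)^(p^{i₁}) · M / (M + p^{i₁})`; in particular
`q` has `p`-adic valuation `0`, and `(a_{i₁} - 1)·q + a_{i₁}` has `p`-adic valuation
at least `1`. -/
theorem stmt18 (p v : ℕ) (hp : p.Prime) (hoddp : Odd p) (hv : 1 ≤ v)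
    (i i₁ i₂ : ℕ) (h1 : i < i₁) (h2 : i₁ < i₂)
    (hai : dig p v i ≠ 0) (hai1 : 2 ≤ dig p v i₁) (hai2 : dig p v i₂ ≠ 0)
    (S T : Finset ℕ) (hSdef : S = Finset.Ico i i₁) (hTdef : T = Finset.Ico i₁ i₂)
    (M : ℤ)
    (hMdef : M = (∑ k ∈ Finset.Ico i₂ v, (dig p v k : ℤ) * (p : ℤ) ^ k)
      - ∑ k ∈ Finset.Ico i₁ i₂, (dig p v k : ℤ) * (p : ℤ) ^ k)
    (q : ℚ) (hqdef : q = lam p v T / lam p (vdownN p v S) T) :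
    q = (-1 : ℚ) ^ (p ^ i₁) * (M : ℚ) / ((M : ℚ) + (p : ℚ) ^ i₁) ∧
    padicValRat p q = 0 ∧
    1 ≤ padicValRat p (((dig p v i₁ : ℚ) - 1) * q + (dig p v i₁ : ℚ)) := by
  have hp2 : 2 ≤ p := hp.two_le
  have : Fact p.Prime := ⟨hp⟩
  subst hSdef hTdef
  set w := vdownN p v (Finset.Ico i i₁) with hw
  have hpos : ∀ n, 0 < p ^ n := fun n => by positivity
  have hy2 : v / p ^ i₂ ≠ 0 := fun h => hai2 (by simp [dig, h])
  have hy1 : v / p ^ i₁ ≠ 0 := fun h => by simp [dig, h] at hai1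
  have hym : v / p ^ i₁ % p ≠ 0 := fun h => by simp [dig, h] at hai1
  have hwd : w / p ^ i₁ = v / p ^ i₁ - 1 := vdownN_div p v i i₁ hp2 h1 hai hy1
  have hwbig : ∀ s, i₁ < s → w / p ^ s = v / p ^ s := by
    intro s hs
    obtain ⟨t, rfl⟩ := Nat.exists_eq_add_of_lt hs
    rw [add_assoc, pow_add, ← Nat.div_div_eq_div_mul, ← Nat.div_div_eq_div_mul, hwd,
      pred_div p _ t hp2 hym]
  have hdw1 : dig p v i₁ = dig p w i₁ + 1 := by
    unfold dig at *
    rw [hwd]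
    have h := Nat.div_add_mod (v / p ^ i₁) p
    have h' : v / p ^ i₁ % p < p := Nat.mod_lt _ (by omega)
    have : v / p ^ i₁ - 1 = p * (v / p ^ i₁ / p) + (v / p ^ i₁ % p - 1) := by omega
    rw [this, Nat.mul_add_mod, Nat.mod_eq_of_lt (show v / p ^ i₁ % p - 1 < p by omega)]
    omega
  have hdw : ∀ s, i₁ < s → dig p w s = dig p v s := by
    intro s hs
    unfold dig
    rw [hwbig s hs]
  -- the scalar M
  have hM : M = aux p v i₂ i₁ := by
    have hle : i₂ ≤ v := by
      by_contra hcon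
      exact hy2 (Nat.div_eq_of_lt (lt_pow_of_le p v i₂ hp2 (by omega)))
    rw [hMdef, sum_dig_Ico p v _ _ hle, sum_dig_Ico p v _ _ h2.le,
      Nat.mod_eq_of_lt (lt_pow_of_le p v v hp2 le_rfl)]
    unfold aux
    have e1 := Nat.div_add_mod v (p ^ i₁)
    have e2 := Nat.div_add_mod v (p ^ i₂)
    omega
  have hMw : aux p w i₂ i₁ = M + (p : ℤ) ^ i₁ := by
    rw [hM]
    unfold aux
    rw [hwbig i₂ h2, hwd]
    push_cast [Nat.one_le_iff_ne_zero.mpr hy1]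
    ring
  have hHw : aux p w i₂ i₂ = aux p v i₂ i₂ := by
    unfold aux
    rw [hwbig i₂ h2]
  have hMpos : 0 < M := hM ▸ aux_pos p v i₂ i₁ hp2 hy2
  have hHpos : 0 < aux p v i₂ i₂ := aux_pos p v i₂ i₂ hp2 hy2
  have hsign : (∏ s ∈ Finset.Ico i₁ i₂, (-1 : ℚ) ^ (dig p v s * p ^ s))
      = (-1 : ℚ) ^ (p ^ i₁) * ∏ s ∈ Finset.Ico i₁ i₂, (-1 : ℚ) ^ (dig p w s * p ^ s) := by
    rw [Finset.prod_eq_prod_Ico_succ_bot h2, Finset.prod_eq_prod_Ico_succ_bot h2, ← mul_assoc,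
      hdw1]
    congr 1
    · rw [← pow_add]
      congr 1
      ring
    · refine Finset.prod_congr rfl fun s hs => ?_
      rw [Finset.mem_Ico] at hs
      rw [hdw s (by omega)]
  have hP0 : (∏ s ∈ Finset.Ico i₁ i₂, (-1 : ℚ) ^ (dig p w s * p ^ s)) ≠ 0 :=
    Finset.prod_ne_zero_iff.mpr fun s _ => pow_ne_zero _ (by norm_num)
  have hMq : (0 : ℚ) < M := by exact_mod_cast hMpos
  have hHq : (0 : ℚ) < (aux p v i₂ i₂ : ℚ) := by exact_mod_cast hHpos
  have hpq : (0 : ℚ) < (p : ℚ) ^ i₁ := by exact_mod_cast hpos i₁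
  have hMMq : (M : ℚ) + (p : ℚ) ^ i₁ ≠ 0 := by positivity
  have hq : q = (-1 : ℚ) ^ (p ^ i₁) * (M : ℚ) / ((M : ℚ) + (p : ℚ) ^ i₁) := by
    rw [hqdef, lam_Ico p v i₁ i₂ hp2 h2.le hy2,
      lam_Ico p w i₁ i₂ hp2 h2.le (by rw [hwbig i₂ h2]; exact hy2), hsign, hMw, hHw, ← hM]
    push_cast
    field_simp
  refine ⟨hq, ?_⟩
  -- factor out p ^ i₁
  obtain ⟨t, ht⟩ := Nat.exists_eq_add_of_lt h2
  set a := dig p v i₁ with ha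
  have halt : a < p := Nat.mod_lt _ (by omega)
  obtain ⟨n, hn⟩ : ∃ n : ℤ, M + (a : ℤ) * (p : ℤ) ^ i₁ = (p : ℤ) ^ i₁ * (p * n) := by
    refine ⟨2 * ((p ^ t * (v / p ^ i₂) : ℕ) : ℤ) - ((v / p ^ i₁ / p : ℕ) : ℤ), ?_⟩
    have h := Nat.div_add_mod (v / p ^ i₁) p
    have h' : ((v / p ^ i₁ : ℕ) : ℤ) = p * ((v / p ^ i₁ / p : ℕ) : ℤ) + a := by
      rw [ha]; unfold dig; exact_mod_cast h.symm
    rw [hM]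
    unfold aux
    rw [Nat.cast_mul (p ^ i₁), h', Nat.cast_mul (p ^ i₂)]
    have : ((p ^ i₂ : ℕ) : ℤ) = (p : ℤ) ^ i₁ * p ^ t * p := by
      rw [ht]; push_cast; ring
    rw [this]
    push_cast
    ring
  have hnpos : 0 < M + (a : ℤ) * (p : ℤ) ^ i₁ := by positivity
  have hn0 : n ≠ 0 := by
    rintro rfl
    simp at hn
    omega
  have hMm : M = (p : ℤ) ^ i₁ * (p * n - a) := by linear_combination hn
  have hodd : (-1 : ℚ) ^ (p ^ i₁) = -1 := (hoddp.pow).neg_one_pow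
  have hmd : ¬ (p : ℤ) ∣ (p * n - a) := by
    intro hd
    have : (p : ℤ) ∣ (a : ℤ) := (dvd_sub_right (Dvd.intro _ rfl)).mp hd
    have := Nat.le_of_dvd (by omega) (Int.natCast_dvd_natCast.mp this)
    omega
  have hmd1 : ¬ (p : ℤ) ∣ (p * n - a + 1) := by
    intro hd
    have e : (p : ℤ) * n - a + 1 = p * n - ((a - 1 : ℕ) : ℤ) := by
      push_cast [show 1 ≤ a by omega]
      ring
    rw [e] at hd
    have : (p : ℤ) ∣ ((a - 1 : ℕ) : ℤ) := (dvd_sub_right (Dvd.intro _ rfl)).mp hd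
    have := Nat.le_of_dvd (by omega) (Int.natCast_dvd_natCast.mp this)
    omega
  set m : ℤ := p * n - a with hm
  have hm0 : m ≠ 0 := fun h => hmd (h ▸ dvd_zero _)
  have hm10 : m + 1 ≠ 0 := fun h => hmd1 (h ▸ dvd_zero _)
  have hm0q : (m : ℚ) ≠ 0 := by exact_mod_cast hm0
  have hm1q : (m : ℚ) + 1 ≠ 0 := by exact_mod_cast hm10
  have hp0q : (p : ℚ) ≠ 0 := by exact_mod_cast hp.ne_zero
  have hv0 : padicValRat p (m : ℚ) = 0 := by
    rw [padicValRat.of_int, padicValInt.eq_zero_of_not_dvd hmd]; rfl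
  have hv1 : padicValRat p ((m : ℚ) + 1) = 0 := by
    have : ((m : ℚ) + 1) = ((m + 1 : ℤ) : ℚ) := by push_cast; rfl
    rw [this, padicValRat.of_int, padicValInt.eq_zero_of_not_dvd hmd1]; rfl
  have hq' : q = -((m : ℚ) / ((m : ℚ) + 1)) := by
    rw [hq, hodd, hMm]
    push_cast
    rw [show (p : ℚ) ^ i₁ * (m : ℚ) + (p : ℚ) ^ i₁ = (p : ℚ) ^ i₁ * ((m : ℚ) + 1) by ring]
    field_simp
  constructor
  · rw [hq', padicValRat.neg, padicValRat.div hm0q hm1q, hv0, hv1, sub_zero]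
  · have hmq : (m : ℚ) = p * n - a := by rw [hm]; push_cast; ring
    have hnq : (n : ℚ) ≠ 0 := by exact_mod_cast hn0
    have e : ((a : ℚ) - 1) * q + (a : ℚ) = (p : ℚ) * n / ((m : ℚ) + 1) := by
      rw [hq', eq_div_iff hm1q]
      field_simp
      rw [hmq]
      ring
    rw [e, padicValRat.div (mul_ne_zero hp0q hnq) hm1q, padicValRat.mul hp0q hnq, hv1,
      padicValRat.self hp.one_lt, padicValRat.of_int]
    omega

end SL2Tilt
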